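/- In a tensor probability space, the usual free cumulants decompose as sums of tensor free cumulants over tuples whose join recovers the permutation: for every α ∈ S_p and elements x₁,...,x_p, one has κ̃_α(x₁,...,x_p) = Σ κ_{β̲}(x₁,...,x_p), where the sum runs over r-tuples (β₁,...,β_r) with each β_s ≤ α in the geodesic order and β₁ ∨ ⋯ ∨ β_r = α in the lattice S_{NC}(α). -/

import Mathlib

open scoped Classical

/-- The length `|σ|` of a permutation: the minimal number of transpositions whose
product equals `σ`. -/
noncomputable def permLength {α : Type*} [DecidableEq α] [Fintype α] (σ : Equiv.Perm α) : ℕ :=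
  sInf {n | ∃ l : List (Equiv.Perm α), l.length = n ∧ (∀ τ ∈ l, τ.IsSwap) ∧ l.prod = σ}

/-- The geodesic order: `α ≤ β` iff `|α| + |α⁻¹β| = |β|`. -/
def geoLe {α : Type*} [DecidableEq α] [Fintype α] (σ τ : Equiv.Perm α) : Prop :=
  permLength σ + permLength (σ⁻¹ * τ) = permLength τ

/-- The Möbius function `Möb(σ) = ∏_{c ∈ Cycles(σ)} (−1)^{|c|} Cat_{|c|}`. -/
def moeb {p : ℕ} (σ : Equiv.Perm (Fin p)) : ℂ :=
  ∏ c ∈ σ.cycleFactorsFinset,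
    ((-1 : ℂ) ^ (c.support.card - 1) * (catalan (c.support.card - 1) : ℂ))

open Equiv Equiv.Perm

section CycleStructure

variable {X : Type*} [DecidableEq X]

theorem formPerm_append_cons (x y : X) (l₁ l₂ : List X) :
    (x :: l₁ ++ y :: l₂).formPerm = (x :: l₁ ++ [y]).formPerm * (y :: l₂).formPerm := by
  induction l₁ generalizing x with
  | nil => cases l₂ <;> simp
  | cons a l₁ ih =>
    have := ih a
    simp only [List.cons_append, List.formPerm_cons_cons] at this ⊢
    rw [this, mul_assoc]

theorem swap_mul_formPerm (i j : X) (l₁ l₂ : List X) (h : (i :: l₁ ++ j :: l₂).Nodup) :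
    swap i j * (i :: l₁ ++ j :: l₂).formPerm = (i :: l₁).formPerm * (j :: l₂).formPerm := by
  have hn : (j :: i :: l₁).Nodup := by
    simp only [List.cons_append, List.nodup_cons, List.nodup_append, List.mem_append,
      List.mem_cons] at h ⊢
    grind
  have hr : (i :: l₁ ++ [j]).formPerm = (j :: i :: l₁).formPerm := by
    rw [← List.formPerm_rotate_one _ hn]
    simp
  rw [formPerm_append_cons, hr, List.formPerm_cons_cons, swap_comm j i, ← mul_assoc, ← mul_assoc,
    swap_mul_self, one_mul]

theorem disjoint_formPerm {l : List X} {ρ : Perm X} (h : ∀ x ∈ l, ρ x = x) :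
    Perm.Disjoint l.formPerm ρ := fun x => by
  by_cases hx : x ∈ l
  · exact Or.inr (h x hx)
  · exact Or.inl (List.formPerm_apply_of_notMem hx)

theorem mem_of_sameCycle_swap_mul {σ : Perm X} {i j : X} {S : Set X}
    (hS : ∀ x, σ x ∈ S ↔ x ∈ S) (hij : i ∈ S ↔ j ∈ S) {x y : X}
    (h : (swap i j * σ).SameCycle x y) : x ∈ S ↔ y ∈ S := by
  have hstep (x : X) : (swap i j * σ) x ∈ S ↔ x ∈ S := by
    rw [Perm.mul_apply, ← hS x]
    rcases eq_or_ne (σ x) i with h | h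
    · rw [h, swap_apply_left, hij]
    rcases eq_or_ne (σ x) j with h' | h'
    · rw [h', swap_apply_right, hij]
    · rw [swap_apply_of_ne_of_ne h h']
  obtain ⟨n, rfl⟩ := h
  induction n using Int.induction_on with
  | zero => simp
  | succ n ih => rw [add_comm, zpow_add, zpow_one, Perm.mul_apply, hstep]; exact ih
  | pred n ih =>
    refine ih.trans ?_
    rw [← hstep (((swap i j * σ) ^ (-(n : ℤ) - 1)) x), ← Perm.mul_apply, ← zpow_one_add]
    simp

theorem sameCycle_or_of_swap_mul {σ : Perm X} {i j x y : X}
    (h : (swap i j * σ).SameCycle x y) (hn : ¬ σ.SameCycle x y) :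
    (σ.SameCycle x i ∧ σ.SameCycle y j) ∨ (σ.SameCycle x j ∧ σ.SameCycle y i) := by
  have key : ∀ {u v : X}, (swap i j * σ).SameCycle u v → ¬ σ.SameCycle u v →
      σ.SameCycle u i ∨ σ.SameCycle u j := by
    intro u v huv hnuv
    by_contra! hc
    refine hnuv ((mem_of_sameCycle_swap_mul (S := {z | σ.SameCycle u z})
      (fun z => sameCycle_apply_right) ?_ huv).1 (SameCycle.refl _ _))
    simp [hc.1, hc.2]
  have hx := key h hn
  have hy := key h.symm fun h => hn h.symm
  rcases hx with hx | hx <;> rcases hy with hy | hy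
  · exact absurd (hx.trans hy.symm) hn
  · exact Or.inl ⟨hx, hy⟩
  · exact Or.inr ⟨hx, hy⟩
  · exact absurd (hx.trans hy.symm) hn

variable [Fintype X]

theorem prod_cycleType_formPerm_mul {M : Type*} [CommMonoid M] (w : ℕ → M) (hw : w 1 = 1)
    {l : List X} (hl : l.Nodup) (hne : l ≠ []) {ρ : Perm X} (h : ∀ x ∈ l, ρ x = x) :
    ((l.formPerm * ρ).cycleType.map w).prod = w l.length * (ρ.cycleType.map w).prod := by
  rw [(disjoint_formPerm h).cycleType_mul, Multiset.map_add, Multiset.prod_add]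
  congr 1
  match l, hne with
  | [a], _ => simp [hw]
  | a :: b :: l, _ =>
    rw [(List.isCycle_formPerm hl (by simp)).cycleType,
      List.support_formPerm_of_nodup _ hl (by simp), List.toFinset_card_of_nodup hl]
    simp

theorem exists_eq_formPerm_mul (σ : Perm X) {i : X} (hi : σ i ≠ i) :
    ∃ (l : List X) (ρ : Perm X), (i :: l).Nodup ∧ l ≠ [] ∧ σ = (i :: l).formPerm * ρ ∧
      (∀ x ∈ i :: l, ρ x = x) ∧ ∀ x, x ∈ i :: l ↔ σ.SameCycle i x := by
  have hmem : ∀ x, x ∈ toList σ i ↔ σ.SameCycle i x := fun x => by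
    rw [mem_toList_iff]; simp [hi]
  have h2 := (two_le_length_toList_iff_mem_support (p := σ) (x := i)).2 (mem_support.2 hi)
  have h0 : (toList σ i)[0]? = some i := by
    rw [List.getElem?_eq_getElem (by omega), toList_getElem_zero σ i (mem_support.2 hi)]
  have hn := nodup_toList σ i
  have hf := formPerm_toList σ i
  generalize toList σ i = L at *
  match L, h2 with
  | a :: b :: l, _ =>
    obtain rfl : a = i := by simpa using h0
    refine ⟨b :: l, (σ.cycleOf a)⁻¹ * σ, hn, by simp, by rw [hf]; simp, fun x hx => ?_, hmem⟩
    rw [hmem] at hx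
    rw [Perm.mul_apply, Perm.inv_eq_iff_eq, hx.cycleOf_apply]

/-- Weights of cycles multiply when a cycle is cut by a transposition. -/
theorem prod_cycleType_swap_mul {M : Type*} [CommMonoid M] (w : ℕ → M) (hw : w 1 = 1)
    {i j : X} {l₁ l₂ : List X} (h : (i :: l₁ ++ j :: l₂).Nodup) {ρ : Perm X}
    (hρ : ∀ x ∈ i :: l₁ ++ j :: l₂, ρ x = x) :
    ((swap i j * ((i :: l₁ ++ j :: l₂).formPerm * ρ)).cycleType.map w).prod =
      w (l₁.length + 1) * (w (l₂.length + 1) * (ρ.cycleType.map w).prod) := by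
  have h' := List.nodup_append.1 h
  rw [← mul_assoc, swap_mul_formPerm i j l₁ l₂ h, mul_assoc,
    prod_cycleType_formPerm_mul w hw h'.1 (by simp),
    prod_cycleType_formPerm_mul w hw h'.2.1 (by simp)]
  · simp
  · exact fun x hx => hρ x (List.mem_append_right _ hx)
  · intro x hx
    rw [Perm.mul_apply, hρ x (List.mem_append_left _ hx)]
    exact List.formPerm_apply_of_notMem fun hx' => h'.2.2 x hx x hx' rfl

/-- The sum of `|c| - 1` over the cycles `c` of `σ`. -/
def cycleDefect (σ : Perm X) : ℕ := (σ.cycleType.map (· - 1)).sum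

theorem cycleDefect_swap_mul_of_sameCycle {σ : Perm X} {i j : X} (hij : i ≠ j)
    (h : σ.SameCycle i j) : cycleDefect (swap i j * σ) + 1 = cycleDefect σ := by
  have hi : σ i ≠ i := fun hi => hij (h.eq_of_left hi)
  obtain ⟨l, ρ, hn, -, hσ, hρ, hm⟩ := exists_eq_formPerm_mul σ hi
  obtain ⟨l₁, l₂, rfl⟩ : ∃ l₁ l₂, l = l₁ ++ j :: l₂ := by
    refine List.append_of_mem ?_
    have := (hm j).2 h
    simpa [hij.symm] using this
  have e (τ : Perm X) : Multiplicative.ofAdd (cycleDefect τ) =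
      (τ.cycleType.map fun n => Multiplicative.ofAdd (n - 1)).prod := by
    simp only [cycleDefect]
    induction τ.cycleType using Multiset.induction with
    | empty => simp
    | cons a s ih => simp [ofAdd_add, ih]
  have h1 := prod_cycleType_swap_mul (fun n => Multiplicative.ofAdd (n - 1)) rfl hn hρ
  have h2 := prod_cycleType_formPerm_mul (fun n => Multiplicative.ofAdd (n - 1)) rfl hn (by simp) hρ
  rw [List.cons_append] at h1
  rw [← hσ, ← e, ← e, ← ofAdd_add] at h2
  rw [← hσ, ← e, ← e, ← ofAdd_add, ← ofAdd_add] at h1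
  have h1 := Multiplicative.ofAdd.injective h1
  have h2 := Multiplicative.ofAdd.injective h2
  simp at h1 h2
  omega

theorem sameCycle_swap_mul_of_not_sameCycle {σ : Perm X} {i j : X}
    (h : ¬ σ.SameCycle i j) : (swap i j * σ).SameCycle i j := by
  obtain ⟨n, hn, hjn⟩ : ∃ n, 0 < n ∧ (σ ^ n) j = j :=
    ⟨orderOf σ, orderOf_pos σ, by simp [pow_orderOf_eq_one]⟩
  classical
  have hex : ∃ n, 0 < n ∧ (σ ^ n) j = j := ⟨n, hn, hjn⟩
  obtain ⟨hm, hjm⟩ := Nat.find_spec hex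
  have hmin := fun k => Nat.find_min (m := k) hex
  generalize Nat.find hex = m at *
  have key : ∀ k < m, ((swap i j * σ) ^ k) j = (σ ^ k) j := by
    intro k hk
    induction k with
    | zero => rfl
    | succ k ih =>
      rw [pow_succ', Perm.mul_apply, ih (by omega), Perm.mul_apply, ← Perm.mul_apply σ,
        ← pow_succ']
      refine swap_apply_of_ne_of_ne (fun hk' => h ?_) fun hk' => hmin _ hk ⟨by omega, hk'⟩
      exact SameCycle.symm ⟨(k + 1 : ℕ), by rw [zpow_natCast]; exact hk'⟩
  obtain ⟨k, rfl⟩ : ∃ k, m = k + 1 := ⟨m - 1, by omega⟩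
  refine SameCycle.symm ⟨(k + 1 : ℕ), ?_⟩
  rw [zpow_natCast, pow_succ', Perm.mul_apply, key k (by omega), Perm.mul_apply,
    ← Perm.mul_apply σ, ← pow_succ', hjm, swap_apply_right]

theorem cycleDefect_swap_mul_of_not_sameCycle {σ : Perm X} {i j : X}
    (h : ¬ σ.SameCycle i j) : cycleDefect (swap i j * σ) = cycleDefect σ + 1 := by
  have hij : i ≠ j := fun hij => h (hij ▸ SameCycle.refl _ _)
  have := cycleDefect_swap_mul_of_sameCycle hij (sameCycle_swap_mul_of_not_sameCycle h)
  rw [← mul_assoc, swap_mul_self, one_mul] at this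
  exact this.symm

theorem exists_swaps_prod_eq (σ : Perm X) :
    ∃ l : List (Perm X), l.length = cycleDefect σ ∧ (∀ τ ∈ l, τ.IsSwap) ∧ l.prod = σ := by
  induction hn : cycleDefect σ generalizing σ with
  | zero =>
    by_cases h : σ = 1
    · exact ⟨[], by simp [h]⟩
    obtain ⟨i, hi⟩ : ∃ i, σ i ≠ i := by
      by_contra! hc
      exact h (Perm.ext hc)
    have := cycleDefect_swap_mul_of_sameCycle hi.symm (sameCycle_apply_right.2 (SameCycle.refl σ i))
    omega
  | succ n ih =>
    obtain ⟨i, hi⟩ : ∃ i, σ i ≠ i := by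
      by_contra! hc
      obtain rfl : σ = 1 := Perm.ext hc
      simp [cycleDefect] at hn
    have := cycleDefect_swap_mul_of_sameCycle hi.symm (sameCycle_apply_right.2 (SameCycle.refl σ i))
    obtain ⟨l, h1, h2, h3⟩ := ih (swap i (σ i) * σ) (by omega)
    refine ⟨swap i (σ i) :: l, by simp [h1], ?_, by simp [h3]⟩
    intro τ hτ
    rcases List.mem_cons.1 hτ with rfl | hτ
    · exact ⟨i, σ i, hi.symm, rfl⟩
    · exact h2 τ hτ

theorem cycleDefect_prod_le (l : List (Perm X)) (hl : ∀ τ ∈ l, τ.IsSwap) :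
    cycleDefect l.prod ≤ l.length := by
  induction l with
  | nil => simp [cycleDefect]
  | cons τ l ih =>
    obtain ⟨i, j, hij, rfl⟩ := hl τ (by simp)
    have := ih fun τ hτ => hl τ (by simp [hτ])
    rw [List.prod_cons, List.length_cons]
    by_cases h : l.prod.SameCycle i j
    · have := cycleDefect_swap_mul_of_sameCycle hij h
      omega
    · have := cycleDefect_swap_mul_of_not_sameCycle h
      omega

theorem permLength_eq_cycleDefect (σ : Perm X) : permLength σ = cycleDefect σ := by
  refine le_antisymm (Nat.sInf_le (exists_swaps_prod_eq σ)) (le_csInf ⟨_, exists_swaps_prod_eq σ⟩ ?_)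
  rintro n ⟨l, rfl, hl, rfl⟩
  exact cycleDefect_prod_le l hl

end CycleStructure

section GeodesicOrder

variable {X : Type*} [DecidableEq X] [Fintype X]

theorem permLength_one : permLength (1 : Perm X) = 0 := by
  simp [permLength_eq_cycleDefect, cycleDefect]

theorem permLength_inv (σ : Perm X) : permLength σ⁻¹ = permLength σ := by
  simp [permLength_eq_cycleDefect, cycleDefect]

theorem permLength_conj (σ τ : Perm X) : permLength (τ * σ * τ⁻¹) = permLength σ := by
  simp only [permLength_eq_cycleDefect, cycleDefect, cycleType_conj]

theorem permLength_mul_le (σ τ : Perm X) : permLength (σ * τ) ≤ permLength σ + permLength τ := by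
  simp only [permLength_eq_cycleDefect]
  obtain ⟨l, hl, hls, rfl⟩ := exists_swaps_prod_eq σ
  obtain ⟨l', hl', hls', rfl⟩ := exists_swaps_prod_eq τ
  rw [← hl, ← hl', ← List.prod_append, ← List.length_append]
  refine cycleDefect_prod_le _ fun τ hτ => ?_
  rcases List.mem_append.1 hτ with h | h
  · exact hls τ h
  · exact hls' τ h

theorem eq_one_of_permLength_eq_zero {σ : Perm X} (h : permLength σ = 0) : σ = 1 := by
  rw [permLength_eq_cycleDefect] at h
  obtain ⟨l, hl, -, rfl⟩ := exists_swaps_prod_eq σ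
  rw [h, List.length_eq_zero_iff] at hl
  simp [hl]

theorem permLength_swap_mul_of_sameCycle {σ : Perm X} {i j : X} (hij : i ≠ j)
    (h : σ.SameCycle i j) : permLength (swap i j * σ) + 1 = permLength σ := by
  simpa only [permLength_eq_cycleDefect] using cycleDefect_swap_mul_of_sameCycle hij h

theorem permLength_swap_mul_of_not_sameCycle {σ : Perm X} {i j : X}
    (h : ¬ σ.SameCycle i j) : permLength (swap i j * σ) = permLength σ + 1 := by
  simpa only [permLength_eq_cycleDefect] using cycleDefect_swap_mul_of_not_sameCycle h

theorem permLength_swap {i j : X} (hij : i ≠ j) : permLength (swap i j) = 1 := by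
  have h := permLength_swap_mul_of_not_sameCycle (σ := (1 : Perm X)) (i := i) (j := j)
    (by simpa using hij)
  rwa [mul_one, permLength_one] at h

theorem not_sameCycle_swap_mul {σ : Perm X} {i j : X} (hij : i ≠ j) (h : σ.SameCycle i j) :
    ¬ (swap i j * σ).SameCycle i j := fun h' => by
  have h1 := permLength_swap_mul_of_sameCycle hij h
  have h2 := permLength_swap_mul_of_sameCycle hij h'
  rw [← mul_assoc, swap_mul_self, one_mul] at h2
  omega

theorem geoLe_refl (σ : Perm X) : geoLe σ σ := by simp [geoLe, permLength_one]

theorem one_geoLe (σ : Perm X) : geoLe 1 σ := by simp [geoLe, permLength_one]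

theorem geoLe.permLength_le {σ τ : Perm X} (h : geoLe σ τ) : permLength σ ≤ permLength τ := by
  unfold geoLe at h; omega

theorem geoLe.eq_of_permLength_le {σ τ : Perm X} (h : geoLe σ τ)
    (hl : permLength τ ≤ permLength σ) : σ = τ :=
  inv_mul_eq_one.1 (eq_one_of_permLength_eq_zero (by unfold geoLe at h; omega))

theorem geoLe.trans {σ τ υ : Perm X} (h : geoLe σ τ) (h' : geoLe τ υ) : geoLe σ υ := by
  have h1 := permLength_mul_le σ (σ⁻¹ * υ)
  have h2 := permLength_mul_le (σ⁻¹ * τ) (τ⁻¹ * υ)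
  simp only [mul_assoc, mul_inv_cancel_left] at h1 h2
  unfold geoLe at *
  omega

theorem geoLe.inv_mul_iff {ζ σ τ : Perm X} (h : geoLe ζ σ) (h' : geoLe ζ τ) :
    geoLe (ζ⁻¹ * σ) (ζ⁻¹ * τ) ↔ geoLe σ τ := by
  unfold geoLe at *
  rw [show (ζ⁻¹ * σ)⁻¹ * (ζ⁻¹ * τ) = σ⁻¹ * τ by group]
  omega

theorem geoLe.le_inv_mul_iff {ζ σ ρ : Perm X} (h : geoLe ζ σ) :
    geoLe ρ (ζ⁻¹ * σ) ↔ geoLe ζ (ζ * ρ) ∧ geoLe (ζ * ρ) σ := by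
  have h1 := permLength_mul_le ζ ρ
  have h2 := permLength_mul_le (ζ * ρ) (ρ⁻¹ * (ζ⁻¹ * σ))
  rw [show ζ * ρ * (ρ⁻¹ * (ζ⁻¹ * σ)) = σ by group] at h2
  unfold geoLe at *
  rw [inv_mul_cancel_left, mul_inv_rev, mul_assoc]
  omega

theorem geoLe.right_of_left {σ τ : Perm X} (h : geoLe σ (σ * τ)) : geoLe τ (σ * τ) := by
  have h1 := permLength_conj σ τ⁻¹
  rw [inv_inv, mul_assoc] at h1
  unfold geoLe at *
  rw [inv_mul_cancel_left] at h
  omega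

theorem geoLe.inv_mul_geoLe {σ τ : Perm X} (h : geoLe σ τ) : geoLe (σ⁻¹ * τ) τ := by
  have := geoLe.right_of_left (σ := σ) (τ := σ⁻¹ * τ) (by simpa using h)
  simpa using this

theorem swap_geoLe_iff {σ : Perm X} {i j : X} : geoLe (swap i j) σ ↔ σ.SameCycle i j := by
  rcases eq_or_ne i j with rfl | hij
  · rw [swap_self]
    exact iff_of_true (one_geoLe σ) (SameCycle.refl _ _)
  rw [geoLe, swap_inv, permLength_swap hij]
  by_cases h : σ.SameCycle i j
  · have := permLength_swap_mul_of_sameCycle hij h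
    simp only [h, iff_true]; omega
  · have := permLength_swap_mul_of_not_sameCycle h
    simp only [h, iff_false]; omega

theorem geoLe.sameCycle {σ τ : Perm X} (h : geoLe σ τ) {x y : X} (hxy : σ.SameCycle x y) :
    τ.SameCycle x y :=
  swap_geoLe_iff.1 ((swap_geoLe_iff.2 hxy).trans h)

theorem exists_upper_bound_of_crossing {α : Perm X} {i j k l : X} (hij : i ≠ j)
    (hkl : k ≠ l) (hα : geoLe (swap i j) α)
    (hn : ¬ (swap i j * α).SameCycle k l) (hki : (swap i j * α).SameCycle k i)
    (hlj : (swap i j * α).SameCycle l j) :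
    ∃ w, ∀ σ, geoLe σ α → geoLe (swap i j) σ → geoLe (swap k l) σ →
      geoLe (swap i j) w ∧ geoLe (swap k l) w ∧ geoLe w σ := by
  have hnij : ¬ (swap i j * α).SameCycle i j := not_sameCycle_swap_mul hij (swap_geoLe_iff.1 hα)
  refine ⟨swap i j * (swap k i * swap l j), fun σ hσ h1 h2 => ?_⟩
  have hle : geoLe (swap i j * σ) (swap i j * α) := by
    simpa using (h1.inv_mul_iff hα).2 hσ
  have hor := sameCycle_or_of_swap_mul (σ := swap i j * σ) (i := i) (j := j) (x := k) (y := l)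
    (by simpa [← mul_assoc] using swap_geoLe_iff.1 h2) fun h => hn (hle.sameCycle h)
  have hki' : (swap i j * σ).SameCycle k i ∧ (swap i j * σ).SameCycle l j := by
    rcases hor with h | h
    · exact h
    · exact absurd (hki.symm.trans (hle.sameCycle h.1)) hnij
  have hkiσ := swap_geoLe_iff.2 hki'.1
  have hljσ : geoLe (swap l j) ((swap k i)⁻¹ * (swap i j * σ)) := by
    rw [swap_geoLe_iff, swap_inv]
    by_contra hc
    have hle' : geoLe (swap k i * (swap i j * σ)) (swap i j * σ) := by
      simpa using hkiσ.inv_mul_geoLe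
    have hlk : ¬ (swap i j * σ).SameCycle l k := fun h => hn (hle.sameCycle h.symm)
    rcases sameCycle_or_of_swap_mul (σ := swap k i * (swap i j * σ)) (i := k) (j := i)
      (by simpa [← mul_assoc] using hki'.2) hc with h | h
    · exact hlk (hle'.sameCycle h.1)
    · exact hlk ((hle'.sameCycle h.1).trans hki'.1.symm)
  have hw := h1.le_inv_mul_iff.1 (by simpa using (hkiσ.le_inv_mul_iff.1 hljσ).2)
  refine ⟨hw.1, swap_geoLe_iff.2 ?_, hw.2⟩
  have hkj : k ≠ j := by rintro rfl; exact hnij hki.symm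
  have hli : l ≠ i := by rintro rfl; exact hnij hlj
  have e1 : (swap i j * (swap k i * swap l j)) k = j := by
    simp [swap_apply_of_ne_of_ne hkl hkj]
  rcases eq_or_ne l j with rfl | hlj'
  · exact ⟨1, e1⟩
  · have e2 : (swap i j * (swap k i * swap l j)) j = l := by
      simp [swap_apply_of_ne_of_ne hkl.symm hli, swap_apply_of_ne_of_ne hli hlj']
    refine sameCycle_apply_left.1 ?_
    rw [e1]
    exact ⟨1, by simpa using e2⟩

/-- Two transpositions below `α` have a common upper bound below all of their common upper bounds
that are at most `α`. -/
theorem exists_join_swaps {α : Perm X} {i j k l : X} (hij : i ≠ j) (hkl : k ≠ l) :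
    ∃ w, ∀ σ, geoLe σ α → geoLe (swap i j) σ → geoLe (swap k l) σ →
      geoLe (swap i j) w ∧ geoLe (swap k l) w ∧ geoLe w σ := by
  by_cases hα : geoLe (swap i j) α
  swap
  · exact ⟨1, fun σ hσ h1 _ => absurd (h1.trans hσ) hα⟩
  by_cases hα' : geoLe (swap k l) α
  swap
  · exact ⟨1, fun σ hσ _ h2 => absurd (h2.trans hσ) hα'⟩
  have hnij : ¬ (swap i j * α).SameCycle i j := not_sameCycle_swap_mul hij (swap_geoLe_iff.1 hα)
  by_cases hβ : (swap i j * α).SameCycle k l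
  · refine ⟨swap i j * swap k l, fun σ hσ h1 h2 => ?_⟩
    have hle : geoLe (swap i j * σ) (swap i j * α) := by
      simpa using (h1.inv_mul_iff hα).2 hσ
    have hkl' : (swap i j * σ).SameCycle k l := by
      by_contra hc
      rcases sameCycle_or_of_swap_mul (σ := swap i j * σ) (i := i) (j := j)
        (by simpa [← mul_assoc] using swap_geoLe_iff.1 h2) hc with h | h
      · exact hnij ((hle.sameCycle h.1).symm.trans (hβ.trans (hle.sameCycle h.2)))
      · exact hnij ((hle.sameCycle h.2).symm.trans (hβ.symm.trans (hle.sameCycle h.1)))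
    have hw := h1.le_inv_mul_iff.1 (by simpa using swap_geoLe_iff.2 hkl')
    exact ⟨hw.1, hw.1.right_of_left, hw.2⟩
  · rcases sameCycle_or_of_swap_mul (σ := swap i j * α) (i := i) (j := j)
      (by simpa [← mul_assoc] using swap_geoLe_iff.1 hα') hβ with h | h
    · exact exists_upper_bound_of_crossing hij hkl hα hβ h.1 h.2
    · have := exists_upper_bound_of_crossing hij hkl.symm hα (fun h => hβ h.symm) h.2 h.1
      rwa [swap_comm l k] at this

theorem geoLe.exists_swap {ζ β : Perm X} (h : geoLe ζ β) (hne : ζ ≠ β) :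
    ∃ i j, i ≠ j ∧ geoLe ζ (ζ * swap i j) ∧ geoLe (ζ * swap i j) β := by
  obtain ⟨i, hi⟩ : ∃ i, (ζ⁻¹ * β) i ≠ i := by
    by_contra! hc
    exact hne (inv_mul_eq_one.1 (Perm.ext hc))
  exact ⟨i, _, hi.symm, h.le_inv_mul_iff.1
    (swap_geoLe_iff.2 (sameCycle_apply_right.2 (SameCycle.refl _ _)))⟩

theorem exists_geoLe_between {α σ τ : Perm X} (hσ : geoLe σ α) (hτ : geoLe τ α) {β γ : Perm X}
    (hβσ : geoLe β σ) (hβτ : geoLe β τ) (hγσ : geoLe γ σ) (hγτ : geoLe γ τ) :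
    ∃ μ, geoLe β μ ∧ geoLe γ μ ∧ geoLe μ σ ∧ geoLe μ τ := by
  suffices H : ∀ (n : ℕ) (ζ β γ : Perm X), permLength σ ≤ permLength ζ + n → geoLe ζ β →
      geoLe ζ γ → geoLe β σ → geoLe β τ → geoLe γ σ → geoLe γ τ →
      ∃ μ, geoLe β μ ∧ geoLe γ μ ∧ geoLe μ σ ∧ geoLe μ τ from
    H (permLength σ) 1 β γ (by omega) (one_geoLe _) (one_geoLe _) hβσ hβτ hγσ hγτ
  intro n
  induction n with
  | zero =>
    intro ζ β γ hn hζβ hζγ hβσ hβτ hγσ hγτ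
    obtain rfl := hζβ.eq_of_permLength_le (hβσ.permLength_le.trans hn)
    exact ⟨γ, hζγ, geoLe_refl γ, hγσ, hγτ⟩
  | succ n ih =>
    intro ζ β γ hn hζβ hζγ hβσ hβτ hγσ hγτ
    rcases eq_or_ne ζ β with rfl | hb
    · exact ⟨γ, hζγ, geoLe_refl γ, hγσ, hγτ⟩
    rcases eq_or_ne ζ γ with rfl | hc
    · exact ⟨β, geoLe_refl β, hζβ, hβσ, hβτ⟩
    obtain ⟨i, j, hij, hx, hxβ⟩ := hζβ.exists_swap hb
    obtain ⟨k, l, hkl, hy, hyγ⟩ := hζγ.exists_swap hc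
    have hζσ := hζβ.trans hβσ
    have hζτ := hζβ.trans hβτ
    have hζα := hζσ.trans hσ
    obtain ⟨w, hw⟩ := exists_join_swaps (α := ζ⁻¹ * α) hij hkl
    obtain ⟨hw1, hw2, hwσ⟩ := hw (ζ⁻¹ * σ) ((hζσ.inv_mul_iff hζα).2 hσ)
      (hζσ.le_inv_mul_iff.2 ⟨hx, hxβ.trans hβσ⟩) (hζσ.le_inv_mul_iff.2 ⟨hy, hyγ.trans hγσ⟩)
    obtain ⟨-, -, hwτ⟩ := hw (ζ⁻¹ * τ) ((hζτ.inv_mul_iff hζα).2 hτ)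
      (hζτ.le_inv_mul_iff.2 ⟨hx, hxβ.trans hβτ⟩) (hζτ.le_inv_mul_iff.2 ⟨hy, hyγ.trans hγτ⟩)
    obtain ⟨hζw, hwσ⟩ := hζσ.le_inv_mul_iff.1 hwσ
    obtain ⟨-, hwτ⟩ := hζτ.le_inv_mul_iff.1 hwτ
    have hxw : geoLe (ζ * swap i j) (ζ * w) := (hx.inv_mul_iff hζw).1 (by simpa using hw1)
    have hyw : geoLe (ζ * swap k l) (ζ * w) := (hy.inv_mul_iff hζw).1 (by simpa using hw2)
    have lx : permLength (ζ * swap i j) = permLength ζ + 1 := by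
      unfold geoLe at hx; rw [inv_mul_cancel_left, permLength_swap hij] at hx; exact hx.symm
    have ly : permLength (ζ * swap k l) = permLength ζ + 1 := by
      unfold geoLe at hy; rw [inv_mul_cancel_left, permLength_swap hkl] at hy; exact hy.symm
    obtain ⟨μ, hβμ, hwμ, hμσ, hμτ⟩ := ih _ β (ζ * w) (by omega) hxβ hxw hβσ hβτ hwσ hwτ
    obtain ⟨ν, hμν, hγν, hνσ, hντ⟩ :=
      ih _ μ γ (by omega) (hyw.trans hwμ) hyγ hμσ hμτ hγσ hγτ
    exact ⟨ν, hβμ.trans hμν, hγν, hνσ, hντ⟩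

/-- `σ` is a minimal common upper bound of the family `b`. -/
def IsGeoJoin {ι : Type*} (b : ι → Perm X) (σ : Perm X) : Prop :=
  (∀ s, geoLe (b s) σ) ∧ ∀ ρ, geoLe ρ σ → (∀ s, geoLe (b s) ρ) → ρ = σ

/-- Joins exist and are unique in the lattice of permutations below `α`. -/
theorem existsUnique_isGeoJoin {ι : Type*} {b : ι → Perm X} {α : Perm X}
    (hb : ∀ s, geoLe (b s) α) : ∃! σ, geoLe σ α ∧ IsGeoJoin b σ := by
  obtain ⟨σ, ⟨hσα, hσb⟩, hmin⟩ := Set.exists_min_image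
    {σ | geoLe σ α ∧ ∀ s, geoLe (b s) σ} permLength (Set.toFinite _) ⟨α, geoLe_refl α, hb⟩
  have hσ : IsGeoJoin b σ := ⟨hσb, fun ρ hρ hρb =>
    hρ.eq_of_permLength_le (hmin ρ ⟨hρ.trans hσα, hρb⟩)⟩
  refine ⟨σ, ⟨hσα, hσ⟩, ?_⟩
  rintro τ ⟨hτα, hτ⟩
  obtain ⟨μ, ⟨hμσ, hμτ⟩, hmax⟩ := Set.exists_max_image
    {μ | geoLe μ σ ∧ geoLe μ τ} permLength (Set.toFinite _) ⟨1, one_geoLe σ, one_geoLe τ⟩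
  have hμb (s) : geoLe (b s) μ := by
    obtain ⟨ν, h1, h2, h3, h4⟩ := exists_geoLe_between hσα hτα (hσ.1 s) (hτ.1 s) hμσ hμτ
    obtain rfl := h2.eq_of_permLength_le (hmax ν ⟨h3, h4⟩)
    exact h1
  rw [← hσ.2 μ hμσ hμb, ← hτ.2 μ hμτ hμb]

end GeodesicOrder

section Moebius

variable {p : ℕ}

/-- The weight `(-1)^(n-1) Cat_(n-1)` of a cycle of length `n`. -/
def cycleWeight (n : ℕ) : ℂ := (-1 : ℂ) ^ (n - 1) * (catalan (n - 1) : ℂ)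

theorem cycleWeight_one : cycleWeight 1 = 1 := by simp [cycleWeight]

theorem moeb_eq_prod_cycleWeight (σ : Perm (Fin p)) :
    moeb σ = (σ.cycleType.map cycleWeight).prod := by
  rw [cycleType_def, Multiset.map_map]
  rfl

theorem sum_cycleWeight_mul (n : ℕ) :
    ∑ k : Fin (n + 1), cycleWeight (k + 1) * cycleWeight (n - k + 1) = -cycleWeight (n + 2) := by
  have (k : Fin (n + 1)) : cycleWeight (k + 1) * cycleWeight (n - k + 1) =
      (-1) ^ n * ((catalan k * catalan (n - k) : ℕ) : ℂ) := by
    have hk : (k : ℕ) + (n - k) = n := by omega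
    simp only [cycleWeight, Nat.add_sub_cancel]
    have hpow : (-1 : ℂ) ^ n = (-1) ^ (k : ℕ) * (-1) ^ (n - k) := by rw [← pow_add, hk]
    rw [hpow]
    push_cast
    ring
  rw [Finset.sum_congr rfl fun k _ => this k, ← Finset.mul_sum, ← Nat.cast_sum, ← catalan_succ]
  simp only [cycleWeight, show n + 2 - 1 = n + 1 from rfl]
  ring

theorem sum_moeb_swap_mul {σ : Perm (Fin p)} {i : Fin p} (hi : σ i ≠ i) :
    ∑ j ∈ Finset.univ.filter (fun j => σ.SameCycle i j), moeb (swap i j * σ) = 0 := by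
  obtain ⟨l, ρ, hn, hne, hσ, hρ, hm⟩ := exists_eq_formPerm_mul σ hi
  have hpos := List.length_pos_of_ne_nil hne
  have hset : Finset.univ.filter (fun j => σ.SameCycle i j) = (i :: l).toFinset := by
    ext j; rw [List.mem_toFinset, hm]; simp
  have hcut (k : Fin l.length) : moeb (swap i l[k] * σ) =
      cycleWeight (k + 1) * cycleWeight (l.length - 1 - k + 1) * moeb ρ := by
    have hk : l = l.take k ++ l[k] :: l.drop (k + 1) := by simp
    have hcons : i :: l = i :: l.take k ++ l[k] :: l.drop (k + 1) := by
      rw [List.cons_append, ← hk]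
    have := prod_cycleType_swap_mul cycleWeight cycleWeight_one (hcons ▸ hn) (hcons ▸ hρ)
    rw [← hcons, ← hσ, ← moeb_eq_prod_cycleWeight, ← moeb_eq_prod_cycleWeight] at this
    rw [this, List.length_take, List.length_drop, min_eq_left (by omega), mul_assoc,
      show l.length - (k + 1) + 1 = l.length - 1 - k + 1 by omega]
  have hi' : moeb (swap i i * σ) = cycleWeight (l.length + 1) * moeb ρ := by
    have := prod_cycleType_formPerm_mul cycleWeight cycleWeight_one hn (by simp) hρ
    rw [← hσ, ← moeb_eq_prod_cycleWeight, ← moeb_eq_prod_cycleWeight, List.length_cons] at this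
    rw [swap_self, ← this]
    rfl
  have hsum : ∑ k : Fin l.length, cycleWeight (k + 1) * cycleWeight (l.length - 1 - k + 1) =
      -cycleWeight (l.length + 1) := by
    obtain ⟨n, hl⟩ : ∃ n, l.length = n + 1 := ⟨l.length - 1, by omega⟩
    rw [hl]
    exact sum_cycleWeight_mul n
  rw [hset, List.sum_toFinset _ hn, List.map_cons, List.sum_cons, hi',
    ← Fin.sum_univ_fun_getElem]
  simp only [Fin.getElem_fin] at hcut
  rw [Finset.sum_congr rfl fun k _ => hcut k, ← Finset.sum_mul, ← add_mul, hsum, add_neg_cancel, zero_mul]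

theorem geoLe_mul_swap_iff {τ α : Perm (Fin p)} {i j : Fin p} (hτ : τ i = i) :
    geoLe (τ * swap i j) α ↔ geoLe τ α ∧ (τ⁻¹ * α).SameCycle i j := by
  rcases eq_or_ne i j with rfl | hij
  · rw [swap_self]
    exact (and_iff_left (SameCycle.refl _ _)).symm
  have h1 : permLength (τ * swap i j) = permLength τ + 1 := by
    rw [← permLength_inv, mul_inv_rev, swap_inv, ← permLength_inv τ]
    refine permLength_swap_mul_of_not_sameCycle fun h => hij (h.eq_of_left ?_)
    exact Perm.inv_eq_iff_eq.2 hτ.symm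
  have h2 := permLength_mul_le τ (τ⁻¹ * α)
  have h3 := permLength_mul_le (swap i j) (swap i j * (τ⁻¹ * α))
  rw [permLength_swap hij] at h3
  rw [mul_inv_cancel_left] at h2
  rw [← mul_assoc (swap i j), swap_mul_self, one_mul] at h3
  rw [← swap_geoLe_iff]
  unfold geoLe
  rw [h1, permLength_swap hij, mul_inv_rev, swap_inv, mul_assoc]
  omega

theorem sum_moeb_inv_mul_of_ne_one {α : Perm (Fin p)} (hα : α ≠ 1) :
    ∑ τ ∈ Finset.univ.filter (fun τ => geoLe τ α), moeb (τ⁻¹ * α) = 0 := by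
  obtain ⟨i, hi⟩ : ∃ i, α i ≠ i := by
    by_contra! hc
    exact hα (Perm.ext hc)
  have key : ∑ τ ∈ Finset.univ.filter (fun τ => geoLe τ α), moeb (τ⁻¹ * α) =
      ∑ τ ∈ Finset.univ.filter (fun τ => τ i = i ∧ geoLe τ α),
        ∑ j ∈ Finset.univ.filter (fun j => (τ⁻¹ * α).SameCycle i j),
          moeb (swap i j * (τ⁻¹ * α)) := by
    rw [Finset.sum_sigma']
    refine Finset.sum_bij' (fun τ _ => ⟨τ * swap i (τ⁻¹ i), τ⁻¹ i⟩)
      (fun x _ => x.1 * swap i x.2) ?_ ?_ ?_ ?_ ?_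
    · intro τ hτ
      have hfix : (τ * swap i (τ⁻¹ i)) i = i := by simp
      have := (geoLe_mul_swap_iff (α := α) (j := τ⁻¹ i) hfix).1
        (by simpa [mul_assoc] using hτ)
      simpa [hfix] using this
    · rintro ⟨τ, j⟩ h
      simp only [Finset.mem_sigma, Finset.mem_filter, Finset.mem_univ, true_and] at h ⊢
      exact (geoLe_mul_swap_iff h.1.1).2 ⟨h.1.2, h.2⟩
    · intro τ _
      simp [mul_assoc]
    · rintro ⟨τ, j⟩ h
      simp only [Finset.mem_sigma, Finset.mem_filter, Finset.mem_univ, true_and] at h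
      have : (τ * swap i j)⁻¹ i = j := by
        rw [Perm.inv_eq_iff_eq]; simp [h.1.1]
      rw [Sigma.mk.injEq]
      simp only [this, mul_assoc, swap_mul_self, mul_one, heq_eq_eq, and_self]
    · intro τ _
      congr 1
      simp [mul_assoc, ← mul_assoc (swap _ _) (swap _ _)]
  rw [key]
  refine Finset.sum_eq_zero fun τ hτ => sum_moeb_swap_mul fun h => hi ?_
  simp only [Finset.mem_filter] at hτ
  rw [Perm.mul_apply, Perm.inv_eq_iff_eq, hτ.2.1] at h
  exact h

theorem sum_moeb_inv_mul (α : Perm (Fin p)) :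
    ∑ τ ∈ Finset.univ.filter (fun τ => geoLe τ α), moeb (τ⁻¹ * α) = if α = 1 then 1 else 0 := by
  split_ifs with h
  · subst h
    have : Finset.univ.filter (fun τ : Perm (Fin p) => geoLe τ 1) = {1} := by
      ext τ
      simp only [Finset.mem_filter, Finset.mem_univ, true_and, Finset.mem_singleton]
      refine ⟨fun h => h.eq_of_permLength_le (by simp [permLength_one]), ?_⟩
      rintro rfl
      exact geoLe_refl 1
    rw [this]
    simp [moeb_eq_prod_cycleWeight]
  · exact sum_moeb_inv_mul_of_ne_one h

theorem sum_moeb (α : Perm (Fin p)) :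
    ∑ τ ∈ Finset.univ.filter (fun τ => geoLe τ α), moeb τ = if α = 1 then 1 else 0 := by
  rw [← sum_moeb_inv_mul]
  refine Finset.sum_bij' (fun τ _ => α * τ⁻¹) (fun τ _ => τ⁻¹ * α) ?_ ?_ ?_ ?_ ?_
  · intro τ hτ
    simp only [Finset.mem_filter, Finset.mem_univ, true_and] at hτ ⊢
    have := permLength_conj (τ⁻¹ * α) τ
    rw [mul_inv_cancel_left] at this
    unfold geoLe at *
    rw [mul_inv_rev, inv_inv, inv_mul_cancel_right, this]
    omega
  · intro τ hτ
    simp only [Finset.mem_filter, Finset.mem_univ, true_and] at hτ ⊢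
    exact hτ.inv_mul_geoLe
  · intro τ _
    group
  · intro τ _
    group
  · intro τ _
    congr 1
    group

theorem sum_geoLe_translate {M : Type*} [AddCommMonoid M] (f : Perm (Fin p) → M)
    {ρ α : Perm (Fin p)} (h : geoLe ρ α) :
    ∑ σ ∈ Finset.univ.filter (fun σ => geoLe ρ σ ∧ geoLe σ α), f (ρ⁻¹ * σ) =
      ∑ τ ∈ Finset.univ.filter (fun τ => geoLe τ (ρ⁻¹ * α)), f τ := by
  refine Finset.sum_bij' (fun σ _ => ρ⁻¹ * σ) (fun τ _ => ρ * τ) ?_ ?_ ?_ ?_ ?_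
  · intro σ hσ
    simpa [h.le_inv_mul_iff] using hσ
  · intro τ hτ
    simpa [h.le_inv_mul_iff] using hτ
  · simp
  · simp
  · simp

theorem sum_Icc_moeb_left {ρ α : Perm (Fin p)} (h : geoLe ρ α) :
    ∑ σ ∈ Finset.univ.filter (fun σ => geoLe ρ σ ∧ geoLe σ α), moeb (ρ⁻¹ * σ) =
      if ρ = α then 1 else 0 := by
  rw [sum_geoLe_translate moeb h, sum_moeb]
  simp only [inv_mul_eq_one]

theorem sum_Icc_moeb_right {ρ α : Perm (Fin p)} (h : geoLe ρ α) :
    ∑ σ ∈ Finset.univ.filter (fun σ => geoLe ρ σ ∧ geoLe σ α), moeb (σ⁻¹ * α) =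
      if ρ = α then 1 else 0 := by
  have := sum_geoLe_translate (fun τ => moeb (τ⁻¹ * (ρ⁻¹ * α))) h
  rw [sum_moeb_inv_mul] at this
  simp only [mul_inv_rev, inv_inv, mul_assoc, mul_inv_cancel_left, inv_mul_eq_one] at this
  exact this

/-- The tensor free cumulant indexed by the tuple `b`. -/
noncomputable def tensorCumulant {r : ℕ} (φt : (Fin r → Perm (Fin p)) → ℂ) (b : Fin r → Perm (Fin p)) : ℂ :=
  ∑ a ∈ Finset.univ.filter (fun a : Fin r → Perm (Fin p) => ∀ s, geoLe (a s) (b s)),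
    φt a * ∏ s, moeb ((a s)⁻¹ * b s)

/-- Summing tensor free cumulants over all tuples below `σ` recovers the moment at `σ`. -/
theorem sum_tensorCumulant {r : ℕ} (φt : (Fin r → Perm (Fin p)) → ℂ) (σ : Perm (Fin p)) :
    ∑ b ∈ Finset.univ.filter (fun b : Fin r → Perm (Fin p) => ∀ s, geoLe (b s) σ),
      tensorCumulant φt b = φt fun _ => σ := by
  have hswap : ∑ b ∈ Finset.univ.filter (fun b : Fin r → Perm (Fin p) => ∀ s, geoLe (b s) σ),
      tensorCumulant φt b =
      ∑ a ∈ Finset.univ.filter (fun a : Fin r → Perm (Fin p) => ∀ s, geoLe (a s) σ),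
        ∑ b ∈ Fintype.piFinset
          (fun s => Finset.univ.filter (fun τ => geoLe (a s) τ ∧ geoLe τ σ)),
          φt a * ∏ s, moeb ((a s)⁻¹ * b s) := by
    refine Finset.sum_comm' fun b a => ?_
    simp only [Finset.mem_filter, Finset.mem_univ, true_and, Fintype.mem_piFinset]
    exact ⟨fun h => ⟨fun s => ⟨h.2 s, h.1 s⟩, fun s => (h.2 s).trans (h.1 s)⟩,
      fun h => ⟨fun s => (h.1 s).2, fun s => (h.1 s).1⟩⟩
  have hprod (a : Fin r → Perm (Fin p)) :
      ∑ b ∈ Fintype.piFinset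
        (fun s => Finset.univ.filter (fun τ => geoLe (a s) τ ∧ geoLe τ σ)),
          ∏ s, moeb ((a s)⁻¹ * b s) =
      ∏ s, ∑ τ ∈ Finset.univ.filter (fun τ => geoLe (a s) τ ∧ geoLe τ σ),
        moeb ((a s)⁻¹ * τ) :=
    (Finset.prod_univ_sum _ fun s τ => moeb ((a s)⁻¹ * τ)).symm
  rw [hswap, Finset.sum_eq_single (fun _ => σ)]
  · rw [← Finset.mul_sum, hprod]
    simp [sum_Icc_moeb_left (geoLe_refl σ)]
  · intro a ha hne
    simp only [Finset.mem_filter, Finset.mem_univ, true_and] at ha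
    obtain ⟨s, hs⟩ := Function.ne_iff.1 hne
    rw [← Finset.mul_sum, hprod, Finset.prod_eq_zero (Finset.mem_univ s), mul_zero]
    rw [sum_Icc_moeb_left (ha s), if_neg hs]
  · intro h
    simp [geoLe_refl] at h

/-- Grouping the tuples below `α` by their join. -/
theorem sum_sum_isGeoJoin {r : ℕ} (f : (Fin r → Perm (Fin p)) → ℂ) (α : Perm (Fin p)) :
    ∑ σ ∈ Finset.univ.filter (fun σ => geoLe σ α),
      ∑ b ∈ Finset.univ.filter (fun b : Fin r → Perm (Fin p) => IsGeoJoin b σ), f b =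
    ∑ b ∈ Finset.univ.filter (fun b : Fin r → Perm (Fin p) => ∀ s, geoLe (b s) α), f b := by
  rw [Finset.sum_comm' (t' := Finset.univ.filter
    (fun b : Fin r → Perm (Fin p) => ∀ s, geoLe (b s) α))
    (s' := fun b => Finset.univ.filter (fun σ => geoLe σ α ∧ IsGeoJoin b σ))]
  · refine Finset.sum_congr rfl fun b hb => ?_
    simp only [Finset.mem_filter, Finset.mem_univ, true_and] at hb
    obtain ⟨σ, hσ, huniq⟩ := existsUnique_isGeoJoin hb
    have : Finset.univ.filter (fun σ => geoLe σ α ∧ IsGeoJoin b σ) = {σ} := by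
      ext τ
      simp only [Finset.mem_filter, Finset.mem_univ, true_and, Finset.mem_singleton]
      exact ⟨huniq τ, fun h => h ▸ hσ⟩
    rw [this, Finset.sum_singleton]
  · intro σ b
    simp only [Finset.mem_filter, Finset.mem_univ, true_and]
    exact ⟨fun h => ⟨h, fun s => (h.2.1 s).trans h.1⟩, fun h => h.1⟩

/-- Möbius inversion over the permutations below `α`. -/
theorem sum_mul_moeb_of_sum_eq {f g : Perm (Fin p) → ℂ}
    (h : ∀ σ, ∑ ρ ∈ Finset.univ.filter (fun ρ => geoLe ρ σ), g ρ = f σ) (α : Perm (Fin p)) :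
    ∑ σ ∈ Finset.univ.filter (fun σ => geoLe σ α), f σ * moeb (σ⁻¹ * α) = g α := by
  simp only [← h, Finset.sum_mul]
  rw [Finset.sum_comm' (t' := Finset.univ.filter (fun ρ => geoLe ρ α))
    (s' := fun ρ => Finset.univ.filter (fun σ => geoLe ρ σ ∧ geoLe σ α))]
  · rw [Finset.sum_eq_single α]
    · rw [← Finset.mul_sum, sum_Icc_moeb_right (geoLe_refl α), if_pos rfl, mul_one]
    · intro ρ hρ hne
      simp only [Finset.mem_filter, Finset.mem_univ, true_and] at hρ
      rw [← Finset.mul_sum, sum_Icc_moeb_right hρ, if_neg hne, mul_zero]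
    · intro h
      simp [geoLe_refl] at h
  · intro σ ρ
    simp only [Finset.mem_filter, Finset.mem_univ, true_and]
    exact ⟨fun h => ⟨⟨h.2, h.1⟩, h.2.trans h.1⟩, fun h => ⟨h.1.2, h.1.1⟩⟩

end Moebius

/-- Free cumulants decompose as sums of tensor free cumulants: with tensor moments
`φt : (S_p)^r → ℂ` (for fixed elements `x₁,…,x_p`), the free cumulant
`κ̃_α = Σ_{σ ≤ α} φ_σ Möb(σ⁻¹α)` (with `φ_σ = φt(σ,…,σ)` by consistency) equals the sum of
the tensor free cumulants `κ_β̲ = Σ_{a̲ ≤ β̲} φt(a̲) ∏_s Möb(a_s⁻¹β_s)` over tuples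
`β̲` with `β_s ≤ α` for all `s` and join `β₁ ∨ ⋯ ∨ β_r = α` in the lattice `S_{NC}(α)`
(the join equals `α` iff the only common upper bound of the `β_s` inside `S_{NC}(α)` is `α`). -/
theorem freeCumulant_eq_sum_tensorCumulants {p r : ℕ}
    (φt : (Fin r → Equiv.Perm (Fin p)) → ℂ) (α : Equiv.Perm (Fin p)) :
    (∑ σ ∈ Finset.univ.filter (fun σ : Equiv.Perm (Fin p) => geoLe σ α),
        φt (fun _ => σ) * moeb (σ⁻¹ * α))
    = ∑ b ∈ Finset.univ.filter
        (fun b : Fin r → Equiv.Perm (Fin p) =>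
          (∀ s, geoLe (b s) α) ∧
          (∀ σ : Equiv.Perm (Fin p), geoLe σ α → (∀ s, geoLe (b s) σ) → σ = α)),
        ∑ a ∈ Finset.univ.filter
            (fun a : Fin r → Equiv.Perm (Fin p) => ∀ s, geoLe (a s) (b s)),
          φt a * ∏ s, moeb ((a s)⁻¹ * b s) := by
  refine (sum_mul_moeb_of_sum_eq (f := fun σ => φt fun _ => σ) (g := fun σ =>
    ∑ b ∈ Finset.univ.filter (fun b : Fin r → Perm (Fin p) => IsGeoJoin b σ),
      tensorCumulant φt b) (fun σ => ?_) α).trans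
    (Finset.sum_congr (Finset.filter_congr fun b _ => Iff.rfl) fun _ _ => rfl)
  rw [sum_sum_isGeoJoin, sum_tensorCumulant]
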